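/- Let p ∈ (2,6] and ℓ > 0. There exists μ₂ > 0 such that for every μ ∈ (0, μ₂) and every continuously differentiable ℓ-periodic function u : ℝ → ℂ with ∫₀^ℓ |u(x)|² dx = μ, one has (1/2)∫₀^ℓ |u'(x)|² dx − (1/p)∫₀^ℓ |u(x)|^p dx ≥ −(ℓ/p)·(μ/ℓ)^(p/2); that is, the energy of u is at least the energy E(κ_μ) = −(ℓ/p)(μ/ℓ)^(p/2) of the constant function κ_μ = √(μ/ℓ), so the constant is a ground state of mass μ on the circle. -/

import Mathlib

open Real MeasureTheory intervalIntegral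

lemma Real.rpow_sub_rpow_mul_sq_sub_sq_le {a m n : ℝ} (ha4 : a ≤ 4)
    (hn : 0 ≤ n) (hnm : n ≤ m) (hm : 0 < m) :
    (m ^ a - n ^ a) * (m ^ 2 - n ^ 2) ≤ 8 * m ^ a * (m - n) ^ 2 := by
  obtain ⟨t, rfl⟩ : ∃ t, n = m * t := ⟨n / m, by field_simp⟩
  have ht0 : 0 ≤ t := nonneg_of_mul_nonneg_right hn hm
  have ht1 : t ≤ 1 := by nlinarith
  have hpow : t ^ 4 ≤ t ^ a := by
    rw [← Real.rpow_natCast]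
    exact Real.rpow_le_rpow_of_exponent_ge_of_imp ht0 ht1 (by simpa using ha4)
      (fun _ h => by norm_num at h)
  have hbern : 1 - t ^ a ≤ 4 * (1 - t) := by
    nlinarith [sq_nonneg (t ^ 2 - 1), sq_nonneg (t - 1)]
  have hma : 0 < m ^ a := Real.rpow_pos_of_pos hm a
  rw [Real.mul_rpow hm.le ht0]
  have hprod : (1 - t ^ a) * (1 + t) ≤ 8 * (1 - t) := by nlinarith
  have hnonneg : 0 ≤ m ^ a * m ^ 2 * (1 - t) :=
    mul_nonneg (by positivity) (by linarith)
  linarith [mul_le_mul_of_nonneg_left hprod hnonneg]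

lemma Real.rpow_le_tangent_add_sq {p v k δ : ℝ} (hp : 2 < p) (hp6 : p ≤ 6)
    (hv : 0 ≤ v) (hvδ : v ≤ δ) (hk : 0 < k) (hkδ : k ≤ δ) :
    v ^ p ≤ k ^ p + p / 2 * k ^ (p - 2) * (v ^ 2 - k ^ 2)
      + 4 * p * δ ^ (p - 2) * (v - k) ^ 2 := by
  have tangent : v ^ p ≤ k ^ p + p / 2 * v ^ (p - 2) * (v ^ 2 - k ^ 2) := by
    rcases hv.eq_or_lt with rfl | hv
    · rw [Real.zero_rpow (by linarith), Real.zero_rpow (by linarith)]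
      have := Real.rpow_pos_of_pos hk p
      nlinarith
    · have hbern := one_add_mul_self_le_rpow_one_add (s := (k / v) ^ 2 - 1)
        (by nlinarith [sq_nonneg (k / v)]) (p := p / 2) (by linarith)
      have hsq : (1 + ((k / v) ^ 2 - 1)) ^ (p / 2) = k ^ p / v ^ p := by
        rw [add_sub_cancel, ← Real.div_rpow hk.le hv.le, ← Real.rpow_natCast,
          ← Real.rpow_mul (by positivity)]
        congr 1
        push_cast
        ring
      rw [hsq, le_div_iff₀ (Real.rpow_pos_of_pos hv p)] at hbern
      have hsplit : v ^ p = v ^ (p - 2) * v ^ 2 := by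
        rw [← Real.rpow_natCast, ← Real.rpow_add hv]
        norm_num
      have : (k / v) ^ 2 * v ^ p = v ^ (p - 2) * k ^ 2 := by
        rw [hsplit]
        field_simp
      nlinarith
  have increment : (v ^ (p - 2) - k ^ (p - 2)) * (v ^ 2 - k ^ 2)
      ≤ 8 * δ ^ (p - 2) * (v - k) ^ 2 := by
    have hvpow : v ^ (p - 2) ≤ δ ^ (p - 2) := Real.rpow_le_rpow hv hvδ (by linarith)
    have hkpow : k ^ (p - 2) ≤ δ ^ (p - 2) := Real.rpow_le_rpow hk.le hkδ (by linarith)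
    rcases le_total k v with h | h
    · have := Real.rpow_sub_rpow_mul_sq_sub_sq_le (a := p - 2) (by linarith)
        hk.le h (hk.trans_le h)
      nlinarith [sq_nonneg (v - k)]
    · have := Real.rpow_sub_rpow_mul_sq_sub_sq_le (a := p - 2) (by linarith)
        hv h hk
      nlinarith [sq_nonneg (v - k)]
  nlinarith

lemma intervalIntegral.sq_integral_mul_le {a b : ℝ} (hab : a ≤ b) {f g : ℝ → ℝ}
    (hf : Continuous f) (hg : Continuous g) :
    (∫ x in a..b, f x * g x) ^ 2 ≤ (∫ x in a..b, f x ^ 2) * ∫ x in a..b, g x ^ 2 := by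
  have h := discrim_le_zero (a := ∫ x in a..b, f x ^ 2)
    (b := 2 * ∫ x in a..b, f x * g x) (c := ∫ x in a..b, g x ^ 2) fun t => by
      have hnonneg : 0 ≤ ∫ x in a..b, (t * f x + g x) ^ 2 :=
        intervalIntegral.integral_nonneg hab fun x _ => sq_nonneg _
      have hexp : (∫ x in a..b, (t * f x + g x) ^ 2)
          = ∫ x in a..b, (t * t) * f x ^ 2 + (2 * t) * (f x * g x) + g x ^ 2 := by
        congr 1
        ext x
        ring
      rw [hexp, intervalIntegral.integral_add, intervalIntegral.integral_add,
        intervalIntegral.integral_const_mul, intervalIntegral.integral_const_mul] at hnonneg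
      · linarith
      all_goals
        apply Continuous.intervalIntegrable
        fun_prop
  rw [discrim] at h
  linarith

lemma norm_sub_le_integral_of_norm_deriv_le {E : Type*} [NormedAddCommGroup E]
    [NormedSpace ℝ E] [CompleteSpace E] {F F' : ℝ → E} {g : ℝ → ℝ} {a b x y : ℝ}
    (hF : ∀ t, HasDerivAt F (F' t) t) (hF' : Continuous F') (hg : Continuous g)
    (hbound : ∀ t, ‖F' t‖ ≤ g t) (hx : x ∈ Set.Icc a b) (hy : y ∈ Set.Icc a b) :
    ‖F x - F y‖ ≤ ∫ t in a..b, g t := by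
  wlog hyx : y ≤ x generalizing x y
  · rw [norm_sub_rev]
    exact this hy hx (le_of_not_ge hyx)
  rw [← intervalIntegral.integral_eq_sub_of_hasDerivAt (fun t _ => hF t)
    (hF'.intervalIntegrable _ _)]
  calc ‖∫ t in y..x, F' t‖ ≤ ∫ t in y..x, g t :=
        intervalIntegral.norm_integral_le_of_norm_le hyx
          (Filter.Eventually.of_forall fun t _ => hbound t) (hg.intervalIntegrable _ _)
    _ ≤ ∫ t in a..b, g t :=
        intervalIntegral.integral_mono_interval hy.1 hyx hx.2
          (Filter.Eventually.of_forall fun t => (norm_nonneg _).trans (hbound t))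
          (hg.intervalIntegrable _ _)

lemma exists_norm_sq_eq_integral_div {E : Type*} [NormedAddCommGroup E] {ℓ : ℝ} (hℓ : 0 < ℓ)
    {u : ℝ → E} (hu : Continuous u) :
    ∃ x ∈ Set.Icc 0 ℓ, ‖u x‖ ^ 2 = (∫ t in (0:ℝ)..ℓ, ‖u t‖ ^ 2) / ℓ := by
  obtain ⟨x, hx, hux⟩ := exists_eq_interval_average hℓ.ne
    (f := fun t => ‖u t‖ ^ 2) (by fun_prop)
  rw [interval_average_eq_div, sub_zero] at hux
  rw [Set.uIoo_of_lt hℓ] at hx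
  exact ⟨x, Set.Ioo_subset_Icc_self hx, hux⟩

lemma sq_norm_sub_le_mul_integral_sq_norm_deriv {E : Type*} [NormedAddCommGroup E]
    [NormedSpace ℝ E] [CompleteSpace E] {u : ℝ → E} (hu : ContDiff ℝ 1 u) {ℓ x y : ℝ}
    (hx : x ∈ Set.Icc 0 ℓ) (hy : y ∈ Set.Icc 0 ℓ) :
    ‖u x - u y‖ ^ 2 ≤ ℓ * ∫ t in (0:ℝ)..ℓ, ‖deriv u t‖ ^ 2 := by
  have hdu : Continuous (deriv u) := hu.continuous_deriv_one
  have hsub := norm_sub_le_integral_of_norm_deriv_le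
    (fun t => (hu.differentiable one_ne_zero t).hasDerivAt) hdu hdu.norm (fun t => le_rfl) hx hy
  have hcs := intervalIntegral.sq_integral_mul_le (hx.1.trans hx.2)
    (continuous_const (y := (1 : ℝ))) hdu.norm
  simp only [one_mul, one_pow, intervalIntegral.integral_const, sub_zero, smul_eq_mul,
    mul_one] at hcs
  exact (pow_le_pow_left₀ (norm_nonneg _) hsub 2).trans hcs

lemma sq_sub_norm_sq_le_mul_integral_sq_norm_deriv {E : Type*} [NormedAddCommGroup E]
    [InnerProductSpace ℝ E] {u : ℝ → E} (hu : ContDiff ℝ 1 u) {ℓ x y : ℝ}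
    (hx : x ∈ Set.Icc 0 ℓ) (hy : y ∈ Set.Icc 0 ℓ) :
    (‖u x‖ ^ 2 - ‖u y‖ ^ 2) ^ 2
      ≤ 4 * (∫ t in (0:ℝ)..ℓ, ‖u t‖ ^ 2) * ∫ t in (0:ℝ)..ℓ, ‖deriv u t‖ ^ 2 := by
  have hdu : Continuous (deriv u) := hu.continuous_deriv_one
  have huc : Continuous u := hu.continuous
  have hsub := norm_sub_le_integral_of_norm_deriv_le
    (F := fun t => ‖u t‖ ^ 2) (F' := fun t => 2 * inner ℝ (u t) (deriv u t))
    (g := fun t => 2 * (‖u t‖ * ‖deriv u t‖))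
    (fun t => (hu.differentiable one_ne_zero t).hasDerivAt.norm_sq)
    (by fun_prop) (by fun_prop)
    (fun t => by
      rw [norm_mul, Real.norm_two]
      exact mul_le_mul_of_nonneg_left (norm_inner_le_norm _ _) zero_le_two) hx hy
  rw [intervalIntegral.integral_const_mul] at hsub
  have hcs := intervalIntegral.sq_integral_mul_le (hx.1.trans hx.2) huc.norm hdu.norm
  have hsq := pow_le_pow_left₀ (norm_nonneg _) hsub 2
  rw [Real.norm_eq_abs, sq_abs] at hsq
  linarith

lemma integral_norm_rpow_le_of_norm_le {E : Type*} [NormedAddCommGroup E]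
    [NormedSpace ℝ E] [CompleteSpace E] {p ℓ δ k : ℝ} (hp : 2 < p) (hp6 : p ≤ 6) (hℓ : 0 < ℓ)
    (hk : 0 < k) (hkδ : k ≤ δ) {u : ℝ → E} (hu : ContDiff ℝ 1 u)
    (hmass : ∫ x in (0:ℝ)..ℓ, ‖u x‖ ^ 2 = ℓ * k ^ 2) (hbound : ∀ x ∈ Set.Icc 0 ℓ, ‖u x‖ ≤ δ) :
    ∫ x in (0:ℝ)..ℓ, ‖u x‖ ^ p
      ≤ ℓ * k ^ p + 4 * p * δ ^ (p - 2) * ℓ ^ 2 * ∫ x in (0:ℝ)..ℓ, ‖deriv u x‖ ^ 2 := by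
  have huc : Continuous u := hu.continuous
  obtain ⟨y, hy, huy⟩ := exists_norm_sq_eq_integral_div hℓ huc
  rw [hmass, mul_div_cancel_left₀ _ hℓ.ne', sq_eq_sq₀ (norm_nonneg _) hk.le] at huy
  set D := ∫ x in (0:ℝ)..ℓ, ‖deriv u x‖ ^ 2
  have hpoint : ∀ x ∈ Set.Icc 0 ℓ, ‖u x‖ ^ p
      ≤ p / 2 * k ^ (p - 2) * ‖u x‖ ^ 2
        + (k ^ p - p / 2 * k ^ (p - 2) * k ^ 2 + 4 * p * δ ^ (p - 2) * (ℓ * D)) := by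
    intro x hx
    have hsub : (‖u x‖ - k) ^ 2 ≤ ℓ * D := by
      refine le_trans ?_ (sq_norm_sub_le_mul_integral_sq_norm_deriv hu hx hy)
      rw [← huy]
      exact sq_le_sq' (by linarith [norm_sub_norm_le (u y) (u x), norm_sub_rev (u x) (u y)])
        (norm_sub_norm_le _ _)
    have hpδ : 0 ≤ 4 * p * δ ^ (p - 2) :=
      mul_nonneg (by linarith) (Real.rpow_nonneg (hk.le.trans hkδ) _)
    linarith [Real.rpow_le_tangent_add_sq hp hp6 (norm_nonneg (u x)) (hbound x hx) hk hkδ,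
      mul_le_mul_of_nonneg_left hsub hpδ]
  have hint := intervalIntegral.integral_mono_on (μ := volume) hℓ.le
    ((huc.norm.rpow_const fun _ => Or.inr (by linarith)).intervalIntegrable 0 ℓ)
    (Continuous.intervalIntegrable (by fun_prop) 0 ℓ) hpoint
  rw [intervalIntegral.integral_add (Continuous.intervalIntegrable (by fun_prop) 0 ℓ)
    (Continuous.intervalIntegrable (by fun_prop) 0 ℓ), intervalIntegral.integral_const_mul,
    intervalIntegral.integral_const, hmass, smul_eq_mul, sub_zero] at hint
  linarith

lemma integral_norm_rpow_le_of_lt_norm {E : Type*} [NormedAddCommGroup E]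
    [InnerProductSpace ℝ E] {p ℓ δ x : ℝ} (hp : 2 < p) (hp6 : p ≤ 6) (hℓ : 0 < ℓ)
    (hδ : 0 < δ) {u : ℝ → E} (hu : ContDiff ℝ 1 u)
    (hmass : ∫ x in (0:ℝ)..ℓ, ‖u x‖ ^ 2 ≤ ℓ * (δ ^ 2 / 2)) (hx : x ∈ Set.Icc 0 ℓ)
    (hδx : δ < ‖u x‖) :
    ∫ x in (0:ℝ)..ℓ, ‖u x‖ ^ p
      ≤ 16 * δ ^ (p - 6) * (∫ x in (0:ℝ)..ℓ, ‖u x‖ ^ 2) ^ 2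
        * ∫ x in (0:ℝ)..ℓ, ‖deriv u x‖ ^ 2 := by
  have huc : Continuous u := hu.continuous
  obtain ⟨z, hz, hzmax⟩ := isCompact_Icc.exists_isMaxOn ⟨x, hx⟩ huc.norm.continuousOn
  obtain ⟨y, hy, huy⟩ := exists_norm_sq_eq_integral_div hℓ huc
  have hosc := sq_sub_norm_sq_le_mul_integral_sq_norm_deriv hu hz hy
  set m := ∫ x in (0:ℝ)..ℓ, ‖u x‖ ^ 2
  set D := ∫ x in (0:ℝ)..ℓ, ‖deriv u x‖ ^ 2
  set M := ‖u z‖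
  have hm : 0 ≤ m := intervalIntegral.integral_nonneg hℓ.le fun _ _ => sq_nonneg _
  have hδM : δ < M := hδx.trans_le (hzmax hx)
  have hM : 0 < M := hδ.trans hδM
  have hy2 : ‖u y‖ ^ 2 ≤ δ ^ 2 / 2 := by
    rw [huy, div_le_iff₀ hℓ]
    linarith
  have hM4 : M ^ 4 ≤ 16 * m * D := by
    have hhalf : M ^ 2 / 2 ≤ M ^ 2 - ‖u y‖ ^ 2 := by nlinarith
    nlinarith [pow_le_pow_left₀ (by positivity) hhalf 2]
  have hMpow : M ^ (p - 2) ≤ δ ^ (p - 6) * M ^ 4 := by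
    have hsplit : M ^ (p - 2) = M ^ (p - 6) * M ^ 4 := by
      rw [← Real.rpow_natCast, ← Real.rpow_add hM]
      norm_num
      ring_nf
    rw [hsplit]
    exact mul_le_mul_of_nonneg_right
      (Real.rpow_le_rpow_of_nonpos hδ hδM.le (by linarith)) (by positivity)
  have hpoint : ∀ t ∈ Set.Icc 0 ℓ, ‖u t‖ ^ p ≤ M ^ (p - 2) * ‖u t‖ ^ 2 := by
    intro t ht
    have hsplit : ‖u t‖ ^ p = ‖u t‖ ^ (p - 2) * ‖u t‖ ^ 2 := by
      rw [← Real.rpow_natCast, ← Real.rpow_add_of_nonneg (norm_nonneg _) (by linarith)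
        (by norm_num)]
      norm_num
    rw [hsplit]
    exact mul_le_mul_of_nonneg_right
      (Real.rpow_le_rpow (norm_nonneg _) (hzmax ht) (by linarith)) (sq_nonneg _)
  have hint := intervalIntegral.integral_mono_on (μ := volume) hℓ.le
    ((huc.norm.rpow_const fun _ => Or.inr (by linarith)).intervalIntegrable 0 ℓ)
    (Continuous.intervalIntegrable (by fun_prop) 0 ℓ) hpoint
  rw [intervalIntegral.integral_const_mul] at hint
  calc _ ≤ M ^ (p - 2) * m := hint
    _ ≤ δ ^ (p - 6) * (16 * m * D) * m := by gcongr; exact hMpow.trans (by gcongr)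
    _ = _ := by ring

/-- Theorem 2 of the paper on the circle of length `ℓ` (functions on the circle being
represented by `ℓ`-periodic functions on `ℝ`): there exists `μ₂ > 0` such that for
every mass `μ < μ₂`, the constant function `κ_μ = √(μ/ℓ)` is a ground state, i.e.
every `ℓ`-periodic function of mass `μ` has energy at least
`E(κ_μ) = -(ℓ/p)(μ/ℓ)^(p/2)`. -/
theorem stmt11 (p ℓ : ℝ) (hp : 2 < p) (hp6 : p ≤ 6) (hℓ : 0 < ℓ) :
    ∃ μ₂ > 0, ∀ μ : ℝ, 0 < μ → μ < μ₂ →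
      ∀ u : ℝ → ℂ, ContDiff ℝ 1 u → (∀ x : ℝ, u (x + ℓ) = u x) →
        (∫ x in (0:ℝ)..ℓ, ‖u x‖ ^ 2) = μ →
        (1/2) * (∫ x in (0:ℝ)..ℓ, ‖deriv u x‖ ^ 2)
            - (1/p) * (∫ x in (0:ℝ)..ℓ, ‖u x‖ ^ p)
          ≥ -(ℓ/p) * (μ/ℓ) ^ (p/2) := by
  have hp2 : 0 < p - 2 := by linarith
  obtain ⟨δ, hδ, hδpow⟩ : ∃ δ > 0, δ ^ (p - 2) = 1 / (8 * ℓ ^ 2) :=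
    ⟨(1 / (8 * ℓ ^ 2)) ^ (p - 2)⁻¹, by positivity,
      Real.rpow_inv_rpow (by positivity) hp2.ne'⟩
  have hδ6 : 0 < δ ^ (p - 6) := Real.rpow_pos_of_pos hδ _
  refine ⟨min (ℓ * (δ ^ 2 / 2)) (min 1 (1 / (16 * δ ^ (p - 6)))), by positivity, ?_⟩
  intro μ hμ hμlt u hu _ hmass
  obtain ⟨hμδ, hμ1, hμ6⟩ : μ < ℓ * (δ ^ 2 / 2) ∧ μ < 1 ∧ μ < 1 / (16 * δ ^ (p - 6)) := by
    simpa only [lt_min_iff] using hμlt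
  have hD : 0 ≤ ∫ x in (0:ℝ)..ℓ, ‖deriv u x‖ ^ 2 :=
    intervalIntegral.integral_nonneg hℓ.le fun _ _ => sq_nonneg _
  suffices h : ∫ x in (0:ℝ)..ℓ, ‖u x‖ ^ p
      ≤ ℓ * (μ / ℓ) ^ (p / 2) + p / 2 * ∫ x in (0:ℝ)..ℓ, ‖deriv u x‖ ^ 2 by
    have hdiv := mul_le_mul_of_nonneg_left h (by positivity : 0 ≤ 1 / p)
    have hexp : 1 / p * (ℓ * (μ / ℓ) ^ (p / 2) + p / 2 * ∫ x in (0:ℝ)..ℓ, ‖deriv u x‖ ^ 2)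
        = ℓ / p * (μ / ℓ) ^ (p / 2) + 1 / 2 * ∫ x in (0:ℝ)..ℓ, ‖deriv u x‖ ^ 2 := by
      field_simp
    linarith
  by_cases hsmall : ∀ x ∈ Set.Icc 0 ℓ, ‖u x‖ ≤ δ
  · have hksq : √(μ / ℓ) ^ 2 = μ / ℓ := Real.sq_sqrt (by positivity)
    have hkδ : √(μ / ℓ) ≤ δ := by
      rw [Real.sqrt_le_left hδ.le, div_le_iff₀ hℓ]
      nlinarith [sq_nonneg δ]
    have hkp : √(μ / ℓ) ^ p = (μ / ℓ) ^ (p / 2) := by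
      rw [Real.sqrt_eq_rpow, ← Real.rpow_mul (by positivity)]
      ring_nf
    have h := integral_norm_rpow_le_of_norm_le hp hp6 hℓ (by positivity) hkδ hu
      (by rw [hmass, hksq]; field_simp) hsmall
    rw [hkp, hδpow] at h
    convert h using 3
    field_simp
    norm_num
  · push Not at hsmall
    obtain ⟨x, hx, hδx⟩ := hsmall
    have h := integral_norm_rpow_le_of_lt_norm hp hp6 hℓ hδ hu
      (by rw [hmass]; exact hμδ.le) hx hδx
    rw [hmass] at h
    have hcoef : 16 * δ ^ (p - 6) * μ ^ 2 ≤ p / 2 := by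
      rw [lt_div_iff₀ (by positivity)] at hμ6
      nlinarith
    have hconst : 0 ≤ ℓ * (μ / ℓ) ^ (p / 2) := by positivity
    linarith [mul_le_mul_of_nonneg_right hcoef hD]
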